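/- arXiv:2512.12335 — 2 statements merged into one kernel-verified Lean document; each statement's English description precedes it below -/
import Mathlib

section
/- For every E-linear code C of length n, the hull Hull(C) = C ∩ C^⊥ satisfies (Hull(C))_Res = C_Res ∩ (C_Tor)^⊥ and (Hull(C))_Tor = (C_Res)^⊥ ∩ C_Tor. -/
open scoped BigOperators

/-- The non-unital ring `E` of order 4: the pair `(u, v)` represents `uκ + vζ`,
where `ζ = κ + τ`.  Multiplication: `(uκ + vζ)·(u'κ + v'ζ) = u'·(uκ + vζ)`. -/
def RingE : Type := ZMod 2 × ZMod 2

namespace RingE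

instance : AddCommGroup RingE := inferInstanceAs (AddCommGroup (ZMod 2 × ZMod 2))

instance : Mul RingE := ⟨fun a b => Prod.mk (Prod.fst a * Prod.fst b) (Prod.snd a * Prod.fst b)⟩

noncomputable instance : DecidableEq RingE := Classical.decEq _

instance : NonUnitalRing RingE where
  left_distrib a b c := by
    show Prod.mk (Prod.fst a * (Prod.fst b + Prod.fst c))
        (Prod.snd a * (Prod.fst b + Prod.fst c)) = _
    show _ = Prod.mk (Prod.fst a * Prod.fst b + Prod.fst a * Prod.fst c)
        (Prod.snd a * Prod.fst b + Prod.snd a * Prod.fst c)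
    simp [mul_add]
  right_distrib a b c := by
    show Prod.mk ((Prod.fst a + Prod.fst b) * Prod.fst c)
        ((Prod.snd a + Prod.snd b) * Prod.fst c) = _
    show _ = Prod.mk (Prod.fst a * Prod.fst c + Prod.fst b * Prod.fst c)
        (Prod.snd a * Prod.fst c + Prod.snd b * Prod.fst c)
    simp [add_mul]
  zero_mul a := by
    show Prod.mk ((0 : ZMod 2) * Prod.fst a) ((0 : ZMod 2) * Prod.fst a) = ((0 : ZMod 2), (0 : ZMod 2))
    simp
  mul_zero a := by
    show Prod.mk (Prod.fst a * (0 : ZMod 2)) (Prod.snd a * (0 : ZMod 2)) = ((0 : ZMod 2), (0 : ZMod 2))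
    simp
  mul_assoc a b c := by
    show Prod.mk (Prod.fst a * Prod.fst b * Prod.fst c) (Prod.snd a * Prod.fst b * Prod.fst c)
      = Prod.mk (Prod.fst a * (Prod.fst b * Prod.fst c)) (Prod.snd a * (Prod.fst b * Prod.fst c))
    simp [mul_assoc]

/-- The generator `κ`. -/
def kappa : RingE := Prod.mk 1 0

/-- The generator `τ`. -/
def tau : RingE := Prod.mk 1 1

/-- `ζ = κ + τ`. -/
def zeta : RingE := Prod.mk 0 1

/-- The reduction map `π : E → F₂`, sending `uκ + vζ` to `u`. -/
def pi (a : RingE) : ZMod 2 := Prod.fst a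

/-- `κ·c` for a scalar `c ∈ F₂`, i.e. the element `cκ` of `E`. -/
def kappaSMul (c : ZMod 2) : RingE := Prod.mk c 0

/-- `ζ·c` for a scalar `c ∈ F₂`, i.e. the element `cζ` of `E`. -/
def zetaSMul (c : ZMod 2) : RingE := Prod.mk 0 c

end RingE

namespace ECode

/-- Componentwise reduction `π : Eⁿ → F₂ⁿ`. -/
def piVec {n : ℕ} (x : Fin n → RingE) : Fin n → ZMod 2 := fun i => RingE.pi (x i)

/-- The vector `κv ∈ Eⁿ` attached to `v ∈ F₂ⁿ`. -/
def kappaVec {n : ℕ} (v : Fin n → ZMod 2) : Fin n → RingE := fun i => RingE.kappaSMul (v i)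

/-- The vector `ζv ∈ Eⁿ` attached to `v ∈ F₂ⁿ`. -/
def zetaVec {n : ℕ} (v : Fin n → ZMod 2) : Fin n → RingE := fun i => RingE.zetaSMul (v i)

/-- An `E`-linear code of length `n`: a left `E`-submodule of `Eⁿ`, i.e. an additive
subgroup closed under componentwise left multiplication by elements of `E`. -/
def IsECode {n : ℕ} (C : Set (Fin n → RingE)) : Prop :=
  (0 : Fin n → RingE) ∈ C ∧ (∀ x ∈ C, ∀ y ∈ C, x + y ∈ C) ∧ (∀ x ∈ C, -x ∈ C) ∧
    ∀ (a : RingE), ∀ x ∈ C, (fun i => a * x i) ∈ C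

/-- The residue code `C_Res = π(C)`. -/
def Res {n : ℕ} (C : Set (Fin n → RingE)) : Set (Fin n → ZMod 2) := piVec '' C

/-- The torsion code `C_Tor = {v ∈ F₂ⁿ : ζv ∈ C}`. -/
def Tor {n : ℕ} (C : Set (Fin n → RingE)) : Set (Fin n → ZMod 2) := {v | zetaVec v ∈ C}

/-- A code is free if its residue and torsion codes coincide. -/
def IsFree {n : ℕ} (C : Set (Fin n → RingE)) : Prop := Res C = Tor C

/-- The inner product on `Eⁿ`. -/
def Einner {n : ℕ} (w z : Fin n → RingE) : RingE := ∑ i, w i * z i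

/-- The left dual `C^{⊥L}`. -/
def dualL {n : ℕ} (C : Set (Fin n → RingE)) : Set (Fin n → RingE) :=
  {z | ∀ w ∈ C, Einner z w = 0}

/-- The right dual `C^{⊥R}`. -/
def dualR {n : ℕ} (C : Set (Fin n → RingE)) : Set (Fin n → RingE) :=
  {z | ∀ w ∈ C, Einner w z = 0}

/-- The (two-sided) dual `C^⊥ = C^{⊥L} ∩ C^{⊥R}`. -/
def dualE {n : ℕ} (C : Set (Fin n → RingE)) : Set (Fin n → RingE) := dualL C ∩ dualR C

/-- The left hull `LHull(C) = C ∩ C^{⊥L}`. -/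
def LHull {n : ℕ} (C : Set (Fin n → RingE)) : Set (Fin n → RingE) := C ∩ dualL C

/-- The right hull `RHull(C) = C ∩ C^{⊥R}`. -/
def RHull {n : ℕ} (C : Set (Fin n → RingE)) : Set (Fin n → RingE) := C ∩ dualR C

/-- The hull `Hull(C) = C ∩ C^⊥`. -/
def EHull {n : ℕ} (C : Set (Fin n → RingE)) : Set (Fin n → RingE) := C ∩ dualE C

/-- The Euclidean inner product on `F₂ⁿ`. -/
def Finner {n : ℕ} (w z : Fin n → ZMod 2) : ZMod 2 := ∑ i, w i * z i

/-- The Euclidean dual of an `F₂`-linear code. -/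
def dualF {n : ℕ} (B : Set (Fin n → ZMod 2)) : Set (Fin n → ZMod 2) :=
  {z | ∀ w ∈ B, Finner w z = 0}

/-- The hull of an `F₂`-linear code. -/
def FHull {n : ℕ} (B : Set (Fin n → ZMod 2)) : Set (Fin n → ZMod 2) := B ∩ dualF B

/-- `F₂`-dimension of an `F₂`-linear code (as the dimension of its span). -/
noncomputable def dimF {n : ℕ} (B : Set (Fin n → ZMod 2)) : ℕ :=
  Module.finrank (ZMod 2) (Submodule.span (ZMod 2) B)

/-- Scalar multiplication of a vector of `Eⁿ` by `a ∈ E`. -/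
def smulVec {n : ℕ} (a : RingE) (x : Fin n → RingE) : Fin n → RingE := fun i => a * x i

/-- The left `E`-span `⟨X⟩_E` of a finite set `X ⊆ Eⁿ`. -/
def spanE {n : ℕ} (X : Finset (Fin n → RingE)) : Set (Fin n → RingE) :=
  {y | ∃ c : (Fin n → RingE) → RingE, y = ∑ x ∈ X, smulVec (c x) x}

/-- The additive (`F₂`-) span `⟨X⟩_{F₂}` of a finite set `X ⊆ Eⁿ`: all sums of subsets. -/
def spanF {n : ℕ} (X : Finset (Fin n → RingE)) : Set (Fin n → RingE) :=
  {y | ∃ S : Finset (Fin n → RingE), S ⊆ X ∧ y = ∑ x ∈ S, x}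

/-- `X` is a generating set of the code `D` if `⟨X⟩_E ∪ ⟨X⟩_{F₂} = D`. -/
def IsGenSet {n : ℕ} (X : Finset (Fin n → RingE)) (D : Set (Fin n → RingE)) : Prop :=
  spanE X ∪ spanF X = D

/-- The rank of a (free) code: the minimum cardinality of a generating set. -/
noncomputable def genRank {n : ℕ} (D : Set (Fin n → RingE)) : ℕ :=
  sInf {m | ∃ X : Finset (Fin n → RingE), X.card = m ∧ IsGenSet X D}

/-- Prepending two coordinates to a vector of length `n`. -/
def cons2 {n : ℕ} (a b : RingE) (x : Fin n → RingE) : Fin (n + 2) → RingE :=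
  Fin.cons a (Fin.cons b x)

end ECode

namespace ECode

theorem aux_fst_sum {n : ℕ} (f : Fin n → RingE) :
    Prod.fst (∑ i, f i : RingE) = ∑ i, Prod.fst (f i) :=
  map_sum (AddMonoidHom.mk' (fun a : RingE => (Prod.fst a : ZMod 2)) (fun _ _ => rfl)) f _

theorem aux_snd_sum {n : ℕ} (f : Fin n → RingE) :
    Prod.snd (∑ i, f i : RingE) = ∑ i, Prod.snd (f i) :=
  map_sum (AddMonoidHom.mk' (fun a : RingE => (Prod.snd a : ZMod 2)) (fun _ _ => rfl)) f _

/-- The `ζ`-component of a vector. -/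
def sndVec {n : ℕ} (x : Fin n → RingE) : Fin n → ZMod 2 := fun i => Prod.snd (x i)

theorem einner_eq_zero {n : ℕ} (w z : Fin n → RingE) :
    Einner w z = 0 ↔ Finner (piVec w) (piVec z) = 0 ∧ Finner (sndVec w) (piVec z) = 0 := by
  have h1 : Prod.fst (Einner w z) = Finner (piVec w) (piVec z) := aux_fst_sum _
  have h2 : Prod.snd (Einner w z) = Finner (sndVec w) (piVec z) := aux_snd_sum _
  rw [← h1, ← h2]
  exact Prod.ext_iff

theorem finner_comm {n : ℕ} (w z : Fin n → ZMod 2) : Finner w z = Finner z w := by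
  simp [Finner, mul_comm]

theorem finner_zero {n : ℕ} (w : Fin n → ZMod 2) : Finner w 0 = 0 := by
  simp [Finner]

theorem kappa_mem {n : ℕ} {C : Set (Fin n → RingE)} (hC : IsECode C) {x : Fin n → RingE}
    (hx : x ∈ C) : kappaVec (piVec x) ∈ C := by
  have h := hC.2.2.2 RingE.kappa x hx
  convert h using 1
  funext i
  exact Prod.ext (one_mul _).symm (zero_mul _).symm

theorem pi_mem_tor {n : ℕ} {C : Set (Fin n → RingE)} (hC : IsECode C) {x : Fin n → RingE}
    (hx : x ∈ C) : piVec x ∈ Tor C := by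
  have h := hC.2.2.2 RingE.zeta x hx
  show zetaVec (piVec x) ∈ C
  convert h using 1
  funext i
  exact Prod.ext (zero_mul _).symm (one_mul _).symm

theorem snd_mem_tor {n : ℕ} {C : Set (Fin n → RingE)} (hC : IsECode C) {x : Fin n → RingE}
    (hx : x ∈ C) : sndVec x ∈ Tor C := by
  have h := hC.2.1 x hx _ (hC.2.2.1 _ (kappa_mem hC hx))
  show zetaVec (sndVec x) ∈ C
  convert h using 1
  funext i
  refine Prod.ext ?_ ?_
  · exact (add_neg_cancel (Prod.fst (x i) : ZMod 2)).symm
  · show (Prod.snd (x i) : ZMod 2) = Prod.snd (x i) + -0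
    simp

end ECode

open ECode in
/-- `(Hull C)_Res = C_Res ∩ (C_Tor)^⊥` and `(Hull C)_Tor = (C_Res)^⊥ ∩ C_Tor`. -/
theorem residue_torsion_of_Hull {n : ℕ} (C : Set (Fin n → RingE)) (hC : IsECode C) :
    Res (EHull C) = Res C ∩ dualF (Tor C) ∧ Tor (EHull C) = dualF (Res C) ∩ Tor C := by
  have pz : ∀ v : Fin n → ZMod 2, piVec (zetaVec v) = 0 := fun _ => rfl
  have sz : ∀ v : Fin n → ZMod 2, sndVec (zetaVec v) = v := fun _ => rfl
  have pk : ∀ v : Fin n → ZMod 2, piVec (kappaVec v) = v := fun _ => rfl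
  have sk : ∀ v : Fin n → ZMod 2, sndVec (kappaVec v) = 0 := fun _ => rfl
  constructor
  · ext v
    constructor
    · rintro ⟨x, ⟨hx, -, hR⟩, rfl⟩
      refine ⟨⟨x, hx, rfl⟩, fun w hw => ?_⟩
      exact ((einner_eq_zero _ _).1 (hR _ hw)).2
    · rintro ⟨⟨x, hx, rfl⟩, hv⟩
      refine ⟨kappaVec (piVec x), ⟨kappa_mem hC hx, fun w hw => ?_, fun w hw => ?_⟩, rfl⟩
      · rw [einner_eq_zero, pk, sk, finner_comm, finner_comm 0, finner_zero]
        exact ⟨hv _ (pi_mem_tor hC hw), rfl⟩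
      · rw [einner_eq_zero, pk]
        exact ⟨hv _ (pi_mem_tor hC hw), hv _ (snd_mem_tor hC hw)⟩
  · ext v
    constructor
    · rintro ⟨hv, hL, -⟩
      refine ⟨?_, hv⟩
      rintro _ ⟨w, hw, rfl⟩
      rw [finner_comm]
      exact ((einner_eq_zero _ _).1 (hL _ hw)).2
    · rintro ⟨hd, hv⟩
      refine ⟨hv, fun w hw => ?_, fun w hw => ?_⟩
      · rw [einner_eq_zero, pz, sz, finner_comm, finner_comm v, finner_zero]
        exact ⟨rfl, hd _ ⟨w, hw, rfl⟩⟩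
      · rw [einner_eq_zero, pz, finner_zero, finner_zero]
        exact ⟨rfl, rfl⟩
end

section
/- Let C be a free E-linear code of length n and let g₁, …, g_m ∈ F₂ⁿ be vectors whose F₂-span is Hull(C_Res) = C_Res ∩ (C_Res)^⊥. Then the vectors κg₁, …, κg_m ∈ Eⁿ form a generating set of Hull(C), i.e. ⟨{κg₁, …, κg_m}⟩_E ∪ ⟨{κg₁, …, κg_m}⟩_{F₂} = Hull(C). -/
open scoped BigOperators

namespace ECode

/-- The first-coordinate map on vectors, as an additive hom. -/
def fstHom (n : ℕ) : (Fin n → RingE) →+ (Fin n → ZMod 2) where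
  toFun x := fun i => Prod.fst (x i)
  map_zero' := rfl
  map_add' _ _ := rfl

/-- The second-coordinate map on vectors, as an additive hom. -/
def sndHom (n : ℕ) : (Fin n → RingE) →+ (Fin n → ZMod 2) where
  toFun x := fun i => Prod.snd (x i)
  map_zero' := rfl
  map_add' _ _ := rfl

/-- First coordinate as an additive hom. -/
def fst1 : RingE →+ ZMod 2 where
  toFun x := Prod.fst x
  map_zero' := rfl
  map_add' _ _ := rfl

/-- Second coordinate as an additive hom. -/
def snd1 : RingE →+ ZMod 2 where
  toFun x := Prod.snd x
  map_zero' := rfl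
  map_add' _ _ := rfl

theorem ext_hom {n : ℕ} {x y : Fin n → RingE} (h1 : fstHom n x = fstHom n y)
    (h2 : sndHom n x = sndHom n y) : x = y := by
  funext i
  exact Prod.ext (congrFun h1 i) (congrFun h2 i)

theorem ringE_eq_zero {a : RingE} : a = 0 ↔ fst1 a = 0 ∧ snd1 a = 0 :=
  ⟨fun h => by subst h; exact ⟨rfl, rfl⟩, fun h => Prod.ext h.1 h.2⟩

theorem fst1_inner {n : ℕ} (w z : Fin n → RingE) :
    fst1 (Einner w z) = ∑ i, fstHom n w i * fstHom n z i := by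
  unfold Einner; rw [map_sum]; rfl

theorem snd1_inner {n : ℕ} (w z : Fin n → RingE) :
    snd1 (Einner w z) = ∑ i, sndHom n w i * fstHom n z i := by
  unfold Einner; rw [map_sum]; rfl

theorem fst_smul {n : ℕ} (a : RingE) (v : Fin n → ZMod 2) :
    fstHom n (smulVec a (kappaVec v)) = fst1 a • v := rfl

theorem snd_smul {n : ℕ} (a : RingE) (v : Fin n → ZMod 2) :
    sndHom n (smulVec a (kappaVec v)) = snd1 a • v := rfl

theorem kappa_add_zeta {n : ℕ} (x : Fin n → RingE) :
    x = kappaVec (fstHom n x) + zetaVec (sndHom n x) := by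
  apply ext_hom
  · funext i; exact (add_zero _).symm
  · funext i; exact (zero_add _).symm

theorem mem_code {n : ℕ} {C : Set (Fin n → RingE)} (hC : IsECode C)
    (hfree : IsFree C) (x : Fin n → RingE) :
    x ∈ C ↔ fstHom n x ∈ Res C ∧ sndHom n x ∈ Res C := by
  obtain ⟨h0, hadd, hneg, hmul⟩ := hC
  have key : ∀ v ∈ Res C, kappaVec v ∈ C := by
    rintro v ⟨y, hy, rfl⟩
    have h := hmul RingE.kappa y hy
    convert h using 1
    apply ext_hom
    · funext i; exact (one_mul _).symm
    · funext i; exact (zero_mul _).symm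
  constructor
  · intro hx
    have h1 : fstHom n x ∈ Res C := ⟨x, hx, rfl⟩
    refine ⟨h1, ?_⟩
    rw [hfree]
    show zetaVec _ ∈ C
    have h2 := hadd _ (hneg _ (key _ h1)) _ hx
    have h3 : zetaVec (sndHom n x) = -kappaVec (fstHom n x) + x := by
      rw [eq_neg_add_iff_add_eq]; exact (kappa_add_zeta x).symm
    rw [h3]; exact h2
  · rintro ⟨h1, h2⟩
    rw [kappa_add_zeta x]
    rw [hfree] at h2
    exact hadd _ (key _ h1) _ h2

theorem mem_hull {n : ℕ} {C : Set (Fin n → RingE)} (hC : IsECode C)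
    (hfree : IsFree C) (x : Fin n → RingE) :
    x ∈ EHull C ↔ fstHom n x ∈ Res C ∩ dualF (Res C) ∧
      sndHom n x ∈ Res C ∩ dualF (Res C) := by
  constructor
  · rintro ⟨hx, hL, hR⟩
    have hm := (mem_code hC hfree x).1 hx
    refine ⟨⟨hm.1, ?_⟩, ⟨hm.2, ?_⟩⟩
    · rintro _ ⟨y, hy, rfl⟩
      have h := (ringE_eq_zero.1 (hR y hy)).1
      rw [fst1_inner] at h
      exact h
    · rintro _ ⟨y, hy, rfl⟩
      have h := (ringE_eq_zero.1 (hL y hy)).2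
      rw [snd1_inner] at h
      rw [← h]
      exact Finset.sum_congr rfl fun i _ => mul_comm _ _
  · rintro ⟨⟨a1, a2⟩, b1, b2⟩
    refine ⟨(mem_code hC hfree x).2 ⟨a1, b1⟩, ?_, ?_⟩
    · intro y hy
      have hr := ((mem_code hC hfree y).1 hy).1
      rw [ringE_eq_zero, fst1_inner, snd1_inner]
      refine ⟨?_, ?_⟩
      · rw [← a2 _ hr]; exact Finset.sum_congr rfl fun i _ => mul_comm _ _
      · rw [← b2 _ hr]; exact Finset.sum_congr rfl fun i _ => mul_comm _ _
    · intro y hy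
      have hr := (mem_code hC hfree y).1 hy
      rw [ringE_eq_zero, fst1_inner, snd1_inner]
      exact ⟨a2 _ hr.1, a2 _ hr.2⟩

end ECode

open ECode in
/-- If `C` is free and `g₁, …, g_m` span `Hull(C_Res) = C_Res ∩ (C_Res)^⊥`
over `F₂`, then `κg₁, …, κg_m` form a generating set of `Hull(C)`. -/
theorem hull_generators {n m : ℕ} (C : Set (Fin n → RingE)) (hC : IsECode C)
    (hfree : IsFree C) (g : Fin m → (Fin n → ZMod 2))
    (hspan : (Submodule.span (ZMod 2) (Set.range g) : Set (Fin n → ZMod 2))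
      = Res C ∩ dualF (Res C)) :
    IsGenSet (Finset.image (fun j => kappaVec (g j)) Finset.univ) (EHull C) := by
  classical
  have hg : ∀ j, g j ∈ Submodule.span (ZMod 2) (Set.range g) :=
    fun j => Submodule.subset_span ⟨j, rfl⟩
  have hmem : ∀ x, x ∈ EHull C ↔ fstHom n x ∈ Submodule.span (ZMod 2) (Set.range g) ∧
      sndHom n x ∈ Submodule.span (ZMod 2) (Set.range g) := by
    intro x
    rw [mem_hull hC hfree, ← hspan]; rfl
  have hinj : Function.Injective (kappaVec : (Fin n → ZMod 2) → _) :=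
    fun a b h => congrArg (fstHom n) h
  apply Set.Subset.antisymm
  · rintro y (⟨c, rfl⟩ | ⟨S, hS, rfl⟩)
    · rw [hmem, map_sum, map_sum]
      refine ⟨Submodule.sum_mem _ ?_, Submodule.sum_mem _ ?_⟩
      · intro x hx
        obtain ⟨j, -, rfl⟩ := Finset.mem_image.1 hx
        exact Submodule.smul_mem _ _ (hg j)
      · intro x hx
        obtain ⟨j, -, rfl⟩ := Finset.mem_image.1 hx
        exact Submodule.smul_mem _ _ (hg j)
    · rw [hmem, map_sum, map_sum]
      refine ⟨Submodule.sum_mem _ ?_, Submodule.sum_mem _ ?_⟩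
      · intro x hx
        obtain ⟨j, -, rfl⟩ := Finset.mem_image.1 (hS hx)
        exact hg j
      · intro x hx
        obtain ⟨j, -, rfl⟩ := Finset.mem_image.1 (hS hx)
        exact Submodule.zero_mem _
  · intro y hy
    left
    obtain ⟨h1, h2⟩ := (hmem y).1 hy
    have hr : (Set.range g) = ((Finset.univ.image g : Finset _) : Set (Fin n → ZMod 2)) := by
      simp
    rw [hr, Submodule.mem_span_finset] at h1 h2
    obtain ⟨a, -, ha⟩ := h1
    obtain ⟨b, -, hb⟩ := h2
    refine ⟨fun x => Prod.mk (a (fstHom n x)) (b (fstHom n x)), ?_⟩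
    have hs : ∀ f : (Fin n → RingE) → (Fin n → RingE),
        ∑ x ∈ Finset.image (fun j => kappaVec (g j)) Finset.univ, f x
        = ∑ v ∈ Finset.univ.image g, f (kappaVec v) := by
      intro f
      rw [← Finset.sum_image (f := f) (g := kappaVec) (fun x _ y _ h => hinj h)]
      refine Finset.sum_congr ?_ fun _ _ => rfl
      ext x; simp
    apply ext_hom
    · refine ha.symm.trans ?_
      refine Eq.trans ?_ (congrArg (fstHom n) (hs _)).symm
      rw [map_sum]; rfl
    · refine hb.symm.trans ?_
      refine Eq.trans ?_ (congrArg (sndHom n) (hs _)).symm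
      rw [map_sum]; rfl
end
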